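/- arXiv:1906.08390 — 2 statements merged into one kernel-verified Lean document; each statement's English description precedes it below -/
import Mathlib

section
/- Let α be a real number with 1 − 1/√2 ≤ α ≤ 1, and define ρ : [0,∞) → ℝ by ρ(s) = (1 + s)^α. Then ρ satisfies conditions (ρ1)–(ρ5): ρ is continuous on [0,∞) and four times continuously differentiable on (0,∞); there exist constants C₁, C₂, C₃, C₄ > 0 with |ρ⁽ⁱ⁾(s)| ≤ Cᵢ for all s ∈ (0,∞) and i ∈ {1,2,3,4}; there exists C₅ > 0 with |s·ρ′(s)·ρ″(s)| ≤ C₅ for all s ∈ (0,∞); ρ′(s) ≥ −√2·ρ″(s)·s ≥ 0 for all s ∈ (0,∞); and 2ρ″(s) + ρ‴(s)·s ≤ 0 for all s ∈ (0,∞). -/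
/-- The iterated derivatives of `s ↦ (1 + s) ^ r`. -/
theorem iteratedDeriv_one_add_rpow (r : ℝ) (k : ℕ) (s : ℝ) :
    iteratedDeriv k (fun s : ℝ ↦ (1 + s) ^ r) s =
      (descPochhammer ℝ k).eval r * (1 + s) ^ (r - k) := by
  rw [iteratedDeriv_comp_const_add k (fun x : ℝ ↦ x ^ r) 1, iteratedDeriv_eq_iterate]
  exact Real.iter_deriv_rpow_const r (1 + s) k

/-- The derivatives of positive order of `s ↦ (1 + s) ^ r` are bounded on `(0, ∞)` if `r ≤ 1`. -/
theorem exists_abs_iteratedDeriv_one_add_rpow_le {r : ℝ} (hr : r ≤ 1) {k : ℕ} (hk : 1 ≤ k) :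
    ∃ C > (0 : ℝ), ∀ s ∈ Set.Ioi (0 : ℝ),
      |iteratedDeriv k (fun s : ℝ ↦ (1 + s) ^ r) s| ≤ C := by
  refine ⟨|(descPochhammer ℝ k).eval r| + 1, by positivity, fun s hs ↦ ?_⟩
  have hs : 0 < s := hs
  have hk' : (1 : ℝ) ≤ k := by exact_mod_cast hk
  have h : (1 + s) ^ (r - k) ≤ 1 :=
    Real.rpow_le_one_of_one_le_of_nonpos (by linarith) (by linarith)
  rw [iteratedDeriv_one_add_rpow, abs_mul,
    abs_of_nonneg (show 0 ≤ (1 + s) ^ (r - k) by positivity)]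
  nlinarith [abs_nonneg ((descPochhammer ℝ k).eval r)]

/-- ρ(s) = (1 + s)^α with 1 − 1/√2 ≤ α ≤ 1 satisfies (ρ1)–(ρ5). -/
theorem rpow_rho_satisfies_rho_conditions
    (α : ℝ) (hα₁ : 1 - 1 / Real.sqrt 2 ≤ α) (hα₂ : α ≤ 1)
    (ρ : ℝ → ℝ) (hρ : ∀ s, ρ s = (1 + s) ^ α) :
    -- (ρ1)
    ContinuousOn ρ (Set.Ici 0) ∧ ContDiffOn ℝ 4 ρ (Set.Ioi 0) ∧
    -- (ρ2)
    (∃ C₁ > (0:ℝ), ∀ s ∈ Set.Ioi (0:ℝ), |deriv ρ s| ≤ C₁) ∧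
    (∃ C₂ > (0:ℝ), ∀ s ∈ Set.Ioi (0:ℝ), |iteratedDeriv 2 ρ s| ≤ C₂) ∧
    (∃ C₃ > (0:ℝ), ∀ s ∈ Set.Ioi (0:ℝ), |iteratedDeriv 3 ρ s| ≤ C₃) ∧
    (∃ C₄ > (0:ℝ), ∀ s ∈ Set.Ioi (0:ℝ), |iteratedDeriv 4 ρ s| ≤ C₄) ∧
    -- (ρ3)
    (∃ C₅ > (0:ℝ), ∀ s ∈ Set.Ioi (0:ℝ), |s * deriv ρ s * iteratedDeriv 2 ρ s| ≤ C₅) ∧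
    -- (ρ4)
    (∀ s ∈ Set.Ioi (0:ℝ),
      deriv ρ s ≥ -Real.sqrt 2 * iteratedDeriv 2 ρ s * s ∧
      -Real.sqrt 2 * iteratedDeriv 2 ρ s * s ≥ 0) ∧
    -- (ρ5)
    (∀ s ∈ Set.Ioi (0:ℝ), 2 * iteratedDeriv 2 ρ s + iteratedDeriv 3 ρ s * s ≤ 0) := by
  obtain rfl : ρ = fun s ↦ (1 + s) ^ α := funext hρ
  have hsqrt : 1 < √2 := by
    rw [Real.lt_sqrt] <;> norm_num
  have hsqrt_mul : √2 * (1 - α) ≤ 1 := by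
    have h : √2 * (1 / √2) = 1 := by field_simp
    nlinarith
  have hα₀ : 0 < α := by nlinarith
  have hd₁ (s : ℝ) : deriv (fun s : ℝ ↦ (1 + s) ^ α) s = α * (1 + s) ^ (α - 1) := by
    rw [← iteratedDeriv_one, iteratedDeriv_one_add_rpow]
    simp
  have hd₂ (s : ℝ) : iteratedDeriv 2 (fun s : ℝ ↦ (1 + s) ^ α) s =
      α * (α - 1) * (1 + s) ^ (α - 2) := by
    rw [iteratedDeriv_one_add_rpow]
    simp [descPochhammer_succ_right]
  have hd₃ (s : ℝ) : iteratedDeriv 3 (fun s : ℝ ↦ (1 + s) ^ α) s =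
      α * (α - 1) * (α - 2) * (1 + s) ^ (α - 3) := by
    rw [iteratedDeriv_one_add_rpow]
    simp [descPochhammer_succ_right]
  have hpow₁ {s : ℝ} (hs : 0 < s) : (1 + s) ^ (α - 1) = (1 + s) ^ (α - 2) * (1 + s) := by
    rw [← Real.rpow_add_one (by positivity)]
    ring_nf
  have hpow₂ {s : ℝ} (hs : 0 < s) : (1 + s) ^ (α - 2) = (1 + s) ^ (α - 3) * (1 + s) := by
    rw [← Real.rpow_add_one (by positivity)]
    ring_nf
  refine ⟨?_, ?_, ?_, exists_abs_iteratedDeriv_one_add_rpow_le hα₂ (by norm_num),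
    exists_abs_iteratedDeriv_one_add_rpow_le hα₂ (by norm_num),
    exists_abs_iteratedDeriv_one_add_rpow_le hα₂ (by norm_num), ⟨1, one_pos, fun s hs ↦ ?_⟩,
    fun s hs ↦ ⟨?_, ?_⟩, fun s hs ↦ ?_⟩
  · exact ContinuousOn.rpow_const (by fun_prop) fun s _ ↦ Or.inr hα₀.le
  · exact ContDiffOn.rpow_const_of_ne (by fun_prop) fun s hs ↦ by
      have hs : 0 < s := hs
      positivity
  · simpa only [iteratedDeriv_one] using exists_abs_iteratedDeriv_one_add_rpow_le hα₂ le_rfl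
  all_goals replace hs : 0 < s := hs
  · have h₁ : (1 + s) ^ (α - 1) ≤ 1 :=
      Real.rpow_le_one_of_one_le_of_nonpos (by linarith) (by linarith)
    have hp : 0 < (1 + s) ^ (α - 2) := by positivity
    have hsp : s * (1 + s) ^ (α - 2) ≤ 1 := by nlinarith [hpow₁ hs]
    have hdecay : s * (1 + s) ^ (α - 2) * (1 + s) ^ (α - 1) ≤ 1 :=
      mul_le_one₀ hsp (by positivity) h₁
    have hcoeff : α * α * (1 - α) ≤ 1 :=
      mul_le_one₀ (mul_le_one₀ hα₂ hα₀.le hα₂) (by linarith) (by linarith)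
    have hcoeff₀ : 0 ≤ α * α * (1 - α) := mul_nonneg (by positivity) (by linarith)
    rw [hd₁, hd₂, abs_le]
    have heq : s * (α * (1 + s) ^ (α - 1)) * (α * (α - 1) * (1 + s) ^ (α - 2)) =
        -(α * α * (1 - α) * (s * (1 + s) ^ (α - 2) * (1 + s) ^ (α - 1))) := by ring
    have hle := mul_le_one₀ hcoeff (by positivity) hdecay
    have hnn := mul_nonneg hcoeff₀
      (show 0 ≤ s * (1 + s) ^ (α - 2) * (1 + s) ^ (α - 1) by positivity)
    constructor <;> linarith
  · have hp : 0 ≤ α * (1 + s) ^ (α - 2) := by positivity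
    rw [hd₁, hd₂, hpow₁ hs, ge_iff_le]
    have h : √2 * (1 - α) * s ≤ 1 + s := by nlinarith
    linarith [mul_le_mul_of_nonneg_left h hp]
  · have h : 0 ≤ √2 * (1 - α) * (α * (1 + s) ^ (α - 2) * s) :=
      mul_nonneg (mul_nonneg (by positivity) (by linarith)) (by positivity)
    rw [hd₂]
    linarith
  · have h : 0 ≤ (1 - α) * (α * (1 + s) ^ (α - 3) * (2 + α * s)) :=
      mul_nonneg (by linarith) (by positivity)
    rw [hd₂, hd₃, hpow₂ hs]
    linarith
end

section
/- Let f : ℝ → ℝ be continuously differentiable with f(0) = 0 and f′(0) = 0, and suppose there exist δ > 0 and p > 4 such that f′(t)·t² − f(t)·t ≥ δ·|t|^p for all t ∈ ℝ. Then f(t) > 0 for every t > 0. -/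
/-- under (f1) and (f2), f(t) > 0 for every t > 0. -/
theorem f_pos_of_pos
    (f : ℝ → ℝ) (hf : ContDiff ℝ 1 f) (h0 : f 0 = 0) (h0' : deriv f 0 = 0)
    (δ p : ℝ) (hδ : 0 < δ) (hp : 4 < p)
    (h : ∀ t : ℝ, deriv f t * t ^ 2 - f t * t ≥ δ * |t| ^ p) :
    ∀ t : ℝ, 0 < t → 0 < f t := by
  have hd (t : ℝ) : HasDerivAt f (deriv f t) t :=
    (hf.differentiable one_ne_zero t).hasDerivAt
  have hq (t : ℝ) (ht : 0 < t) :
      HasDerivAt (fun s => f s / s) ((deriv f t * t - f t * 1) / t ^ 2) t :=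
    (hd t).div (hasDerivAt_id t) ht.ne'
  have hlim : ContinuousAt (fun s => f s / s) 0 := by
    have hs := hasDerivAt_iff_tendsto_slope_zero.1 (hd 0)
    rw [continuousAt_iff_punctured_nhds]
    simpa [h0, h0', div_eq_inv_mul] using hs
  have hmono : StrictMonoOn (fun s => f s / s) (Set.Ici 0) := by
    refine strictMonoOn_of_deriv_pos (convex_Ici 0) (fun t ht => ?_) (fun t ht => ?_)
    · rcases (Set.mem_Ici.1 ht).eq_or_lt with rfl | ht
      · exact hlim.continuousWithinAt
      · exact (hq t ht).continuousAt.continuousWithinAt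
    · have ht : 0 < t := by simpa using ht
      rw [(hq t ht).deriv]
      have hpos : 0 < δ * |t| ^ p := by positivity
      have hprod : 0 < (deriv f t * t - f t * 1) * t := by linarith [h t]
      exact div_pos (pos_of_mul_pos_left hprod ht.le) (by positivity)
  intro t ht
  have hlt : f 0 / 0 < f t / t := hmono Set.self_mem_Ici ht.le ht
  rw [div_zero] at hlt
  exact (div_pos_iff_of_pos_right ht).1 hlt
end
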